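/- Let G be a simple graph on [0,n] and k ≥ 0, and suppose the capacitated flow polytope P^c_k of G^(k) with netflow b_G^(k) = (indeg_G(1), ..., indeg_G(n), −k, k−#E(G)) and capacities 0 ≤ f ≤ 1 on the y-edges is nonempty. For I ⊆ [n], define z_I^(k) = min { Σ_{i∈I} f(a_i) : f ∈ P^c_k }. Then the convex hull of { φ(f) : f an integral flow in P^c_k }, where φ(f) = (f(a_1),...,f(a_n)), equals the generalized permutahedron P = { x ∈ ℝ^n : Σ_{i∈I} x_i ≥ z_I^(k) for every proper subset I of [n], and Σ_{i=1}^{n} x_i = z_{[n]}^(k) }, and every integer point of P equals φ(f) for some integral flow f ∈ P^c_k. (Equivalently, the Newton polytope of the degree #E(G)−k homogeneous component L_G^k of the left-degree polynomial is a generalized permutahedron with polytopal support.) -/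

import Mathlib

noncomputable section

open Finset

/-- The flow polytope of a directed graph with edge index set `ι`, edges `e` going from
`src e` to `tgt e`, and netflow vector `a`. -/
def flowPolytope {V ι : Type*} [Fintype ι] [DecidableEq V]
    (src tgt : ι → V) (a : V → ℝ) : Set (ι → ℝ) :=
  {f | (∀ e, 0 ≤ f e) ∧
    ∀ v, (∑ e, if src e = v then f e else 0) - (∑ e, if tgt e = v then f e else 0) = a v}

/-- `E(G\0)`: the edges of `G` not incident to the vertex `0`. -/
def EG0 (n : ℕ) (G : Finset (Fin (n + 1) × Fin (n + 1))) :
    Finset (Fin (n + 1) × Fin (n + 1)) :=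
  G.filter fun e => (e.1 : ℕ) ≠ 0

/-- Source map of the graph `H_G` on the vertex set `[n] ∪ {t}` (modeled as
`Option (Fin (n+1))` with `none = t`; the vertex `some 0` is unused): the edges are the
edges `(j,i)` of `G` with `1 ≤ j < i ≤ n` together with one edge `(j,t)` for each
`j ∈ [n]`. -/
def srcH (n : ℕ) (G : Finset (Fin (n + 1) × Fin (n + 1))) :
    (↥(EG0 n G) ⊕ Fin n) → Option (Fin (n + 1))
  | Sum.inl e => some e.1.1
  | Sum.inr i => some i.succ

/-- Target map of `H_G`. -/
def tgtH (n : ℕ) (G : Finset (Fin (n + 1) × Fin (n + 1))) :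
    (↥(EG0 n G) ⊕ Fin n) → Option (Fin (n + 1))
  | Sum.inl e => some e.1.2
  | Sum.inr _ => none

/-- `indeg_G(v)`: number of edges of `G` ending at `v`. -/
def indeg (n : ℕ) (G : Finset (Fin (n + 1) × Fin (n + 1))) (v : Fin (n + 1)) : ℕ :=
  (G.filter fun e => e.2 = v).card

/-- `outdeg_F(v)`: number of edges of `F` starting at `v`. -/
def outdeg (n : ℕ) (F : Finset (Fin (n + 1) × Fin (n + 1))) (v : Fin (n + 1)) : ℕ :=
  (F.filter fun e => e.1 = v).card

/-- The netflow vector `b_G^F = (indeg_G(1) − outdeg_F(1), …, indeg_G(n) − outdeg_F(n),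
−#E(G\F))` on the vertices of `H_G`. -/
def bGF (n : ℕ) (G F : Finset (Fin (n + 1) × Fin (n + 1))) : Option (Fin (n + 1)) → ℝ
  | none => -((G.card : ℝ) - (F.card : ℝ))
  | some v => if v = 0 then 0 else (indeg n G v : ℝ) - (outdeg n F v : ℝ)

/-- `z_I^F = min { ∑_{i∈I} f(i,t) : f a flow on H_G with netflow b_G^F }`. -/
def zI (n : ℕ) (G F : Finset (Fin (n + 1) × Fin (n + 1))) (I : Finset (Fin n)) : ℝ :=
  sInf ((fun f => ∑ i ∈ I, f (Sum.inr i)) ''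
    flowPolytope (srcH n G) (tgtH n G) (bGF n G F))


/-- `S_F = ψ(integral flows on H_G with netflow b_G^F) ⊆ ℝ^n`, where
`ψ(f) = (f(1,t),…,f(n,t))`. -/
def ldSet (n : ℕ) (G F : Finset (Fin (n + 1) × Fin (n + 1))) : Set (Fin n → ℝ) :=
  {x | ∃ f ∈ flowPolytope (srcH n G) (tgtH n G) (bGF n G F),
    (∀ e, ∃ z : ℤ, f e = (z : ℝ)) ∧ x = fun i => f (Sum.inr i)}

/-- Source map of the graph `G^(k)` on the vertex set `[n+1] ∪ {t}` (modeled as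
`Option (Fin (n+2))` with `none = t` and `some (n+1)` the extra vertex `n+1`; the vertex
`some 0` is unused).  Its edges are: one edge `a_j : j → t` for each `j ∈ [n]`, one edge
`z_{(j,i)} : j → i` for each `(j,i) ∈ E(G\0)`, and one edge `y_{(j,i)} : j → n+1` for
each `(j,i) ∈ E(G\0)`. -/
def srcK (n : ℕ) (G : Finset (Fin (n + 1) × Fin (n + 1))) :
    (Fin n ⊕ ↥(EG0 n G) ⊕ ↥(EG0 n G)) → Option (Fin (n + 2))
  | Sum.inl j => some j.succ.castSucc
  | Sum.inr (Sum.inl e) => some e.1.1.castSucc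
  | Sum.inr (Sum.inr e) => some e.1.1.castSucc

/-- Target map of `G^(k)`. -/
def tgtK (n : ℕ) (G : Finset (Fin (n + 1) × Fin (n + 1))) :
    (Fin n ⊕ ↥(EG0 n G) ⊕ ↥(EG0 n G)) → Option (Fin (n + 2))
  | Sum.inl _ => none
  | Sum.inr (Sum.inl e) => some e.1.2.castSucc
  | Sum.inr (Sum.inr _) => some (Fin.last (n + 1))

/-- The netflow vector `b_G^(k) = (indeg_G(1), …, indeg_G(n), −k, k − #E(G))` on the
vertices of `G^(k)`. -/
def bK (n : ℕ) (G : Finset (Fin (n + 1) × Fin (n + 1))) (k : ℕ) :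
    Option (Fin (n + 2)) → ℝ
  | none => (k : ℝ) - (G.card : ℝ)
  | some v =>
      if (v : ℕ) = n + 1 then -(k : ℝ)
      else if (v : ℕ) = 0 then 0
      else ((G.filter fun e => (e.2 : ℕ) = (v : ℕ)).card : ℝ)

/-- The capacitated flow polytope `P^c_k` of `G^(k)` with netflow `b_G^(k)` and
capacities `0 ≤ f ≤ 1` on the `y`-edges. -/
def capK (n : ℕ) (G : Finset (Fin (n + 1) × Fin (n + 1))) (k : ℕ) :
    Set ((Fin n ⊕ ↥(EG0 n G) ⊕ ↥(EG0 n G)) → ℝ) :=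
  {f | f ∈ flowPolytope (srcK n G) (tgtK n G) (bK n G k) ∧
    ∀ e : ↥(EG0 n G), f (Sum.inr (Sum.inr e)) ≤ 1}


/-- `z_I^(k) = min { ∑_{i∈I} f(a_i) : f ∈ P^c_k }`. -/
def zK (n : ℕ) (G : Finset (Fin (n + 1) × Fin (n + 1))) (k : ℕ)
    (I : Finset (Fin n)) : ℝ :=
  sInf ((fun f => ∑ i ∈ I, f (Sum.inl i)) '' capK n G k)

/-- The netflow of an edge weighting, as a linear map. -/
def netflow {V ι : Type*} [Fintype ι] [DecidableEq V] (src tgt : ι → V) :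
    (ι → ℝ) →ₗ[ℝ] (V → ℝ) where
  toFun f v := (∑ e, if src e = v then f e else 0) - (∑ e, if tgt e = v then f e else 0)
  map_add' f g := by
    funext v
    simp only [Pi.add_apply, ← Finset.sum_sub_distrib, ← Finset.sum_add_distrib]
    refine Finset.sum_congr rfl fun e _ => ?_
    split_ifs <;> ring
  map_smul' c f := by
    funext v
    simp only [Pi.smul_apply, smul_eq_mul, RingHom.id_apply, ← Finset.sum_sub_distrib,
      Finset.mul_sum]
    refine Finset.sum_congr rfl fun e _ => ?_
    split_ifs <;> ring

section Network

variable {V ι : Type*} [Fintype ι] [DecidableEq V] {src tgt : ι → V}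

lemma netflow_apply (f : ι → ℝ) (v : V) :
    netflow src tgt f v =
      (∑ e, if src e = v then f e else 0) - (∑ e, if tgt e = v then f e else 0) := rfl

lemma netflow_single [DecidableEq ι] (e : ι) (c : ℝ) :
    netflow src tgt (Pi.single e c) = Pi.single (src e) c - Pi.single (tgt e) c := by
  funext v
  simp only [netflow_apply, Pi.sub_apply, Pi.single_apply]
  congr 1
  · rw [Finset.sum_eq_single e] <;> simp +contextual [eq_comm]
  · rw [Finset.sum_eq_single e] <;> simp +contextual [eq_comm]

/-- Summation by parts for a potential `p` on the vertices. -/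
lemma sum_mul_netflow [Fintype V] (p : V → ℝ) (f : ι → ℝ) :
    ∑ v, p v * netflow src tgt f v = ∑ e, (p (src e) - p (tgt e)) * f e := by
  have key : ∀ h : ι → V, ∑ v, p v * ∑ e, (if h e = v then f e else 0) =
      ∑ e, p (h e) * f e := by
    intro h
    simp_rw [Finset.mul_sum]
    rw [Finset.sum_comm]
    simp
  simp only [netflow_apply, mul_sub, Finset.sum_sub_distrib, key, sub_mul]

/-- A nonempty set of edges without vertices of degree one supports a nonzero circulation. -/
lemma exists_circulation [Fintype V] [DecidableEq ι] (N : Finset ι) (hN : N.Nonempty)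
    (hdeg : ∀ v, #{e ∈ N | src e = v} + #{e ∈ N | tgt e = v} ≠ 1) :
    ∃ d : ι → ℝ, d ≠ 0 ∧ (∀ e ∉ N, d e = 0) ∧ netflow src tgt d = 0 := by
  set W : Finset V := N.image src ∪ N.image tgt with hW
  have hsW : ∀ e ∈ N, src e ∈ W := fun e he =>
    Finset.mem_union_left _ (Finset.mem_image_of_mem _ he)
  have htW : ∀ e ∈ N, tgt e ∈ W := fun e he =>
    Finset.mem_union_right _ (Finset.mem_image_of_mem _ he)
  have hcard : #W ≤ #N := by
    have h1 := Finset.card_eq_sum_card_fiberwise hsW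
    have h2 := Finset.card_eq_sum_card_fiberwise htW
    have h3 : ∑ _v ∈ W, 2 ≤ ∑ v ∈ W, (#{e ∈ N | src e = v} + #{e ∈ N | tgt e = v}) := by
      refine Finset.sum_le_sum fun v hv => ?_
      have := hdeg v
      have hpos : 0 < #{e ∈ N | src e = v} ∨ 0 < #{e ∈ N | tgt e = v} := by
        simp only [hW, Finset.mem_union, Finset.mem_image] at hv
        simp only [Finset.card_pos, Finset.Nonempty, Finset.mem_filter]
        exact hv
      omega
    rw [Finset.sum_add_distrib, ← h1, ← h2] at h3
    simp at h3
    omega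
  obtain ⟨e₀, he₀⟩ := hN
  have hv₀ := hsW e₀ he₀
  set v₀ := src e₀
  let L : (ι → ℝ) →ₗ[ℝ] ((↥Nᶜ → ℝ) × (↥(W.erase v₀) → ℝ)) :=
    (LinearMap.funLeft ℝ ℝ (Subtype.val : ↥Nᶜ → ι)).prod
      ((LinearMap.funLeft ℝ ℝ (Subtype.val : ↥(W.erase v₀) → V)).comp (netflow src tgt))
  have hker : LinearMap.ker L ≠ ⊥ := by
    apply LinearMap.ker_ne_bot_of_finrank_lt
    simp only [Module.finrank_prod, Module.finrank_fintype_fun_eq_card, Fintype.card_coe,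
      Finset.card_compl, Finset.card_erase_of_mem hv₀]
    have : #N ≤ Fintype.card ι := Finset.card_le_univ N
    have : 0 < #W := Finset.card_pos.2 ⟨_, hv₀⟩
    omega
  obtain ⟨d, hd, hd0⟩ := Submodule.exists_mem_ne_zero_of_ne_bot hker
  rw [LinearMap.mem_ker] at hd
  have hdN : ∀ e ∉ N, d e = 0 := fun e he =>
    congrFun (congrArg Prod.fst hd) ⟨e, Finset.mem_compl.2 he⟩
  have hnet : ∀ v, v ≠ v₀ → netflow src tgt d v = 0 := by
    intro v hv
    by_cases hvW : v ∈ W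
    · exact congrFun (congrArg Prod.snd hd) ⟨v, Finset.mem_erase.2 ⟨hv, hvW⟩⟩
    · rw [netflow_apply, Finset.sum_eq_zero, Finset.sum_eq_zero, sub_zero]
      · intro e _
        split_ifs with h
        · exact hdN e fun he => hvW (h ▸ htW e he)
        · rfl
      · intro e _
        split_ifs with h
        · exact hdN e fun he => hvW (h ▸ hsW e he)
        · rfl
  refine ⟨d, hd0, hdN, ?_⟩
  funext v
  by_cases hv : v = v₀
  · have h := sum_mul_netflow (src := src) (tgt := tgt) (fun _ => 1) d
    rw [Finset.sum_eq_single v₀ (fun w _ hw => by simp [hnet w hw]) (by simp)] at h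
    simpa [hv] using h
  · exact hnet v hv

/-- If the netflow at `v` is an integer, then `v` does not have exactly one incident edge with a
non-integral value. -/
lemma card_nonintegral_ne_one (Z : AddSubgroup ℝ) (g : ι → ℝ) (v : V)
    (hv : netflow src tgt g v ∈ Z) (N : Finset ι) (hN : ∀ e, e ∈ N ↔ g e ∉ Z) :
    #{e ∈ N | src e = v} + #{e ∈ N | tgt e = v} ≠ 1 := by
  classical
  have key : ∀ h : ι → V, (∑ e, if h e = v then g e else 0) - ∑ e ∈ N with h e = v, g e ∈ Z := by
    intro h
    rw [Finset.sum_filter, ← Finset.sum_filter_add_sum_filter_not Finset.univ (· ∈ N)]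
    rw [Finset.filter_mem_eq_inter, Finset.univ_inter, add_sub_cancel_left]
    refine Z.sum_mem fun e he => ?_
    split_ifs
    · by_contra hc
      exact (Finset.mem_filter.1 he).2 ((hN e).2 hc)
    · exact Z.zero_mem
  have hdiff : (∑ e ∈ N with src e = v, g e) - ∑ e ∈ N with tgt e = v, g e ∈ Z := by
    have := Z.add_mem (Z.sub_mem hv (key src)) (key tgt)
    rw [netflow_apply] at this
    convert this using 1
    ring
  intro h1
  rcases Nat.add_eq_one_iff.1 h1 with ⟨h0, h1⟩ | ⟨h1, h0⟩
  all_goals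
    rw [Finset.card_eq_zero] at h0
    obtain ⟨e, he⟩ := Finset.card_eq_one.1 h1
    rw [h0, he] at hdiff
    have heN : e ∈ N := (Finset.mem_filter.1 (he ▸ Finset.mem_singleton_self e)).1
    refine (hN e).1 heN ?_
    simpa using hdiff

/-- Every real flow with integral netflow is a convex combination of integral flows with the same
netflow, all of whose values are obtained by rounding. -/
lemma mem_convexHull_integral [Fintype V] (f : ι → ℝ) (hf : ∀ v, ∃ z : ℤ, netflow src tgt f v = z) :
    f ∈ convexHull ℝ {g : ι → ℝ | netflow src tgt g = netflow src tgt f ∧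
      (∀ e, (⌊f e⌋ : ℝ) ≤ g e ∧ g e ≤ ⌈f e⌉) ∧ ∀ e, ∃ z : ℤ, g e = z} := by
  classical
  set T := {g : ι → ℝ | netflow src tgt g = netflow src tgt f ∧
      (∀ e, (⌊f e⌋ : ℝ) ≤ g e ∧ g e ≤ ⌈f e⌉) ∧ ∀ e, ∃ z : ℤ, g e = z}
  set l : ι → ℝ := fun e => ⌊f e⌋
  set u : ι → ℝ := fun e => ⌈f e⌉
  set Q : Set (ι → ℝ) := (netflow src tgt) ⁻¹' {netflow src tgt f} ∩ Set.Icc l u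
  have hfQ : f ∈ Q := ⟨rfl, fun e => Int.floor_le _, fun e => Int.le_ceil _⟩
  have hcont : Continuous (netflow src tgt) := LinearMap.continuous_of_finiteDimensional _
  have hcomp : IsCompact Q := isCompact_Icc.inter_left (isClosed_singleton.preimage hcont)
  have hconv : Convex ℝ Q :=
    ((convex_singleton _).linear_preimage _).inter (convex_Icc l u)
  have hTfin : T.Finite := by
    refine (Set.Finite.pi' (t := fun e => (fun z : ℤ => (z : ℝ)) '' Set.Icc ⌊f e⌋ ⌈f e⌉)
      fun e => (Set.finite_Icc _ _).image _).subset ?_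
    rintro g ⟨-, hb, hz⟩ e
    obtain ⟨z, hz⟩ := hz e
    have := hb e
    rw [hz] at this
    exact ⟨z, ⟨by exact_mod_cast this.1, by exact_mod_cast this.2⟩, hz.symm⟩
  have hext : Q.extremePoints ℝ ⊆ T := by
    intro g hg
    obtain ⟨⟨hgn, hgl, hgu⟩, hge⟩ := hg
    refine ⟨hgn, fun e => ⟨hgl e, hgu e⟩, ?_⟩
    by_contra! hnon
    obtain ⟨e₀, he₀⟩ := hnon
    set Z : AddSubgroup ℝ := (Int.castAddHom ℝ).range
    have hZ : ∀ r : ℝ, r ∈ Z ↔ ∃ z : ℤ, r = z := fun r => by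
      rw [AddMonoidHom.mem_range]
      simp only [Int.coe_castAddHom, eq_comm]
    set N : Finset ι := Finset.univ.filter fun e => g e ∉ Z with hNdef
    have hN : ∀ e, e ∈ N ↔ g e ∉ Z := fun e => by simp [hNdef]
    obtain ⟨d, hd0, hdN, hdn⟩ := exists_circulation (src := src) (tgt := tgt) N
      ⟨e₀, (hN e₀).2 fun h => by obtain ⟨z, hz⟩ := (hZ _).1 h; exact he₀ z hz⟩
      fun v => card_nonintegral_ne_one Z g v
        ((hZ _).2 (by obtain ⟨z, hz⟩ := hf v; exact ⟨z, (congrFun hgn v).trans hz⟩)) N hN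
    have hstrict : ∀ e ∈ N, l e < g e ∧ g e < u e := by
      intro e he
      have := (hN e).1 he
      rw [hZ] at this
      push Not at this
      exact ⟨lt_of_le_of_ne (hgl e) (this _).symm, lt_of_le_of_ne (hgu e) (this _)⟩
    have hev : ∀ c : ℝ, ∀ᶠ ε in nhdsWithin (0 : ℝ) (Set.Ioi 0), g + (c * ε) • d ∈ Q := by
      intro c
      have hbox : ∀ e, ∀ᶠ ε in nhdsWithin (0 : ℝ) (Set.Ioi 0),
          l e ≤ g e + c * ε * d e ∧ g e + c * ε * d e ≤ u e := by
        intro e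
        by_cases he : e ∈ N
        · have ht : Filter.Tendsto (fun ε : ℝ => g e + c * ε * d e)
              (nhdsWithin 0 (Set.Ioi 0)) (nhds (g e)) := by
            have : Continuous fun ε : ℝ => g e + c * ε * d e := by fun_prop
            have h := this.tendsto 0
            simp only [mul_zero, zero_mul, add_zero] at h
            exact h.mono_left nhdsWithin_le_nhds
          filter_upwards [ht.eventually_const_le (hstrict e he).1,
            ht.eventually_le_const (hstrict e he).2] with ε h1 h2 using ⟨h1, h2⟩
        · simp [hdN e he, hgl e, hgu e]
      filter_upwards [Filter.eventually_all.2 hbox] with ε hε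
      refine ⟨?_, fun e => (hε e).1, fun e => (hε e).2⟩
      simp only [Set.mem_preimage, map_add, map_smul, hdn, smul_zero, add_zero]
      exact hgn
    obtain ⟨ε, ⟨h1, h2⟩, hε⟩ := ((hev 1).and (hev (-1))).and
      (self_mem_nhdsWithin (a := (0 : ℝ)) (s := Set.Ioi 0)) |>.exists
    have hmem : g ∈ openSegment ℝ (g + (1 * ε) • d) (g + (-1 * ε) • d) := by
      refine ⟨1 / 2, 1 / 2, by norm_num, by norm_num, by norm_num, ?_⟩
      funext e
      simp only [Pi.add_apply, Pi.smul_apply, smul_eq_mul]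
      ring
    have := hge h1 h2 hmem
    have hz : (1 * ε) • d = 0 := by simpa using this
    rcases smul_eq_zero.1 hz with h | h
    · rw [one_mul] at h
      exact (ne_of_gt hε) h
    · exact hd0 h
  have hKM := closure_convexHull_extremePoints hcomp hconv
  rw [← hKM] at hfQ
  exact closure_minimal (convexHull_mono hext) (hTfin.isClosed_convexHull ℝ) hfQ

end Network

section CapacitatedFlows

variable {n : ℕ} {G : Finset (Fin (n + 1) × Fin (n + 1))} {k : ℕ}

lemma mem_capK_iff (f : Fin n ⊕ ↥(EG0 n G) ⊕ ↥(EG0 n G) → ℝ) :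
    f ∈ capK n G k ↔ ((∀ e, 0 ≤ f e) ∧ netflow (srcK n G) (tgtK n G) f = bK n G k) ∧
      ∀ e : ↥(EG0 n G), f (Sum.inr (Sum.inr e)) ≤ 1 := by
  rw [funext_iff]
  rfl

lemma exists_int_bK (v : Option (Fin (n + 2))) : ∃ z : ℤ, bK n G k v = z := by
  rcases v with _ | v
  · exact ⟨(k : ℤ) - G.card, by simp [bK]⟩
  · simp only [bK]
    split_ifs
    · exact ⟨-(k : ℤ), by simp⟩
    · exact ⟨0, by simp⟩
    · exact ⟨((G.filter fun e => (e.2 : ℕ) = (v : ℕ)).card : ℤ), by simp⟩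

lemma sum_inl_of_mem_capK {f : Fin n ⊕ ↥(EG0 n G) ⊕ ↥(EG0 n G) → ℝ} (hf : f ∈ capK n G k) :
    ∑ i, f (Sum.inl i) = (G.card : ℝ) - k := by
  have h := congrFun ((mem_capK_iff f).1 hf).1.2 none
  simp only [netflow_apply, Fintype.sum_sum_type, srcK, tgtK, bK] at h
  simp at h
  linarith

lemma zK_le_of_mem_capK {f : Fin n ⊕ ↥(EG0 n G) ⊕ ↥(EG0 n G) → ℝ} (hf : f ∈ capK n G k)
    (I : Finset (Fin n)) : zK n G k I ≤ ∑ i ∈ I, f (Sum.inl i) := by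
  refine csInf_le ⟨0, ?_⟩ ⟨f, hf, rfl⟩
  rintro _ ⟨g, hg, rfl⟩
  exact Finset.sum_nonneg fun i _ => hg.1.1 _

lemma zK_nonneg (I : Finset (Fin n)) : 0 ≤ zK n G k I := by
  refine Real.sInf_nonneg ?_
  rintro _ ⟨g, hg, rfl⟩
  exact Finset.sum_nonneg fun i _ => hg.1.1 _

lemma zK_univ (hne : (capK n G k).Nonempty) : zK n G k Finset.univ = (G.card : ℝ) - k := by
  have : (fun f => ∑ i ∈ Finset.univ, f (Sum.inl i)) '' capK n G k = {(G.card : ℝ) - k} := by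
    refine Set.Subset.antisymm ?_ ?_
    · rintro _ ⟨f, hf, rfl⟩
      exact sum_inl_of_mem_capK hf
    · rintro _ rfl
      obtain ⟨f, hf⟩ := hne
      exact ⟨f, hf, sum_inl_of_mem_capK hf⟩
  rw [zK, this, csInf_singleton]

lemma isCompact_capK (hG : ∀ e ∈ G, e.1 < e.2) : IsCompact (capK n G k) := by
  set p : Option (Fin (n + 2)) → ℝ := fun v => v.elim ((n : ℝ) + 1) fun w => ((w : ℕ) : ℝ)
    with hp
  have hstep : ∀ e, 1 ≤ p (tgtK n G e) - p (srcK n G e) := by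
    have hlt : ∀ e : ↥(EG0 n G), ((e.1.1 : ℕ) : ℝ) + 1 ≤ (e.1.2 : ℕ) := by
      intro e
      have := hG e.1 (Finset.mem_filter.1 e.2).1
      exact_mod_cast this
    have hle : ∀ j : Fin (n + 1), ((j : ℕ) : ℝ) ≤ n := by
      intro j
      exact_mod_cast Nat.lt_succ_iff.1 j.2
    rintro (j | e | e)
    · have := hle j.succ
      simp only [hp, srcK, tgtK, Option.elim, Fin.val_castSucc]
      linarith
    · have := hlt e
      simp only [hp, srcK, tgtK, Option.elim, Fin.val_castSucc]
      linarith
    · have := hlt e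
      have := hle e.1.2
      simp only [hp, srcK, tgtK, Option.elim, Fin.val_castSucc, Fin.val_last]
      push_cast
      linarith
  set C : ℝ := -∑ v, p v * bK n G k v with hC
  have hbound : capK n G k ⊆ Set.Icc (fun _ => 0) (fun _ => C) := by
    intro f hf
    obtain ⟨⟨h0, hn⟩, -⟩ := (mem_capK_iff f).1 hf
    refine ⟨h0, fun e => ?_⟩
    have hs := sum_mul_netflow (src := srcK n G) (tgt := tgtK n G) p f
    rw [hn] at hs
    have hterm : ∀ e, f e ≤ (p (tgtK n G e) - p (srcK n G e)) * f e := fun e =>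
      le_mul_of_one_le_left (h0 e) (hstep e)
    calc f e ≤ (p (tgtK n G e) - p (srcK n G e)) * f e := hterm e
      _ ≤ ∑ e, (p (tgtK n G e) - p (srcK n G e)) * f e :=
        Finset.single_le_sum (f := fun e => (p (tgtK n G e) - p (srcK n G e)) * f e)
          (fun e _ => (h0 e).trans (hterm e)) (Finset.mem_univ e)
      _ = C := by
        rw [hC, hs, ← Finset.sum_neg_distrib]
        exact Finset.sum_congr rfl fun e _ => by ring
  have hcont : Continuous (netflow (srcK n G) (tgtK n G)) :=
    LinearMap.continuous_of_finiteDimensional _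
  refine isCompact_Icc.of_isClosed_subset ?_ hbound
  have : capK n G k = ((⋂ e, {f | 0 ≤ f e}) ∩ netflow (srcK n G) (tgtK n G) ⁻¹' {bK n G k}) ∩
      ⋂ e : ↥(EG0 n G), {f | f (Sum.inr (Sum.inr e)) ≤ 1} := by
    ext f
    simp [mem_capK_iff]
  rw [this]
  refine ((isClosed_iInter fun e => ?_).inter (isClosed_singleton.preimage hcont)).inter
    (isClosed_iInter fun e => ?_)
  · exact isClosed_le continuous_const (continuous_apply e)
  · exact isClosed_le (continuous_apply _) continuous_const

/-- The directions in which the values of `f` on the `z`- and `y`-edges can be changed without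
violating the capacities, the values on the edges to `t` being fixed. -/
def residualCone (f : Fin n ⊕ ↥(EG0 n G) ⊕ ↥(EG0 n G) → ℝ) :
    Set (Fin n ⊕ ↥(EG0 n G) ⊕ ↥(EG0 n G) → ℝ) :=
  {D | (∀ i, D (Sum.inl i) = 0) ∧ (∀ e, f (Sum.inr e) = 0 → 0 ≤ D (Sum.inr e)) ∧
    ∀ e, f (Sum.inr (Sum.inr e)) = 1 → D (Sum.inr (Sum.inr e)) ≤ 0}

/-- The vertices to which flow can be rerouted from `s` inside the residual network of `f`. -/
def residualReach (f : Fin n ⊕ ↥(EG0 n G) ⊕ ↥(EG0 n G) → ℝ) (s : Option (Fin (n + 2))) :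
    Set (Option (Fin (n + 2))) :=
  {v | ∃ D ∈ residualCone f,
    netflow (srcK n G) (tgtK n G) D = Pi.single s 1 - Pi.single v 1}

lemma self_mem_residualReach (f : Fin n ⊕ ↥(EG0 n G) ⊕ ↥(EG0 n G) → ℝ)
    (s : Option (Fin (n + 2))) : s ∈ residualReach f s :=
  ⟨0, by simp [residualCone], by simp⟩

lemma none_notMem_residualReach (f : Fin n ⊕ ↥(EG0 n G) ⊕ ↥(EG0 n G) → ℝ)
    (j : Fin (n + 2)) : none ∉ residualReach f (some j) := by
  rintro ⟨D, hD, hn⟩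
  have h := congrFun hn none
  simp [netflow_apply, Fintype.sum_sum_type, srcK, tgtK, hD.1] at h

lemma residualReach_step {f : Fin n ⊕ ↥(EG0 n G) ⊕ ↥(EG0 n G) → ℝ}
    {s v w : Option (Fin (n + 2))} (hv : v ∈ residualReach f s)
    {D : Fin n ⊕ ↥(EG0 n G) ⊕ ↥(EG0 n G) → ℝ} (hD : D ∈ residualCone f)
    (hn : netflow (srcK n G) (tgtK n G) D = Pi.single v 1 - Pi.single w 1) :
    w ∈ residualReach f s := by
  obtain ⟨D', hD', hn'⟩ := hv
  refine ⟨D' + D, ⟨fun i => ?_, fun e he => ?_, fun e he => ?_⟩, ?_⟩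
  · simp [hD.1, hD'.1]
  · exact add_nonneg (hD'.2.1 e he) (hD.2.1 e he)
  · exact add_nonpos (hD'.2.2 e he) (hD.2.2 e he)
  · rw [map_add, hn, hn', sub_add_sub_cancel]

lemma tgt_mem_residualReach {f : Fin n ⊕ ↥(EG0 n G) ⊕ ↥(EG0 n G) → ℝ}
    {s : Option (Fin (n + 2))} {e : ↥(EG0 n G) ⊕ ↥(EG0 n G)}
    (hv : srcK n G (Sum.inr e) ∈ residualReach f s)
    (he : ∀ y, e = Sum.inr y → f (Sum.inr e) ≠ 1) :
    tgtK n G (Sum.inr e) ∈ residualReach f s := by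
  refine residualReach_step hv (D := Pi.single (Sum.inr e) 1)
    ⟨fun i => by simp, fun e' _ => ?_, fun y hy => ?_⟩ (netflow_single _ _)
  · rw [Pi.single_apply]
    split_ifs <;> norm_num
  · rw [Pi.single_eq_of_ne]
    intro h
    have h := (Sum.inr_injective h).symm
    exact he y h (h ▸ hy)

lemma src_mem_residualReach {f : Fin n ⊕ ↥(EG0 n G) ⊕ ↥(EG0 n G) → ℝ}
    {s : Option (Fin (n + 2))} {e : ↥(EG0 n G) ⊕ ↥(EG0 n G)}
    (hv : tgtK n G (Sum.inr e) ∈ residualReach f s) (he : f (Sum.inr e) ≠ 0) :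
    srcK n G (Sum.inr e) ∈ residualReach f s := by
  refine residualReach_step hv (D := Pi.single (Sum.inr e) (-1))
    ⟨fun i => by simp, fun e' he' => ?_, fun y _ => ?_⟩ ?_
  · rw [Pi.single_eq_of_ne]
    intro h
    exact he (h ▸ he')
  · rw [Pi.single_apply]
    split_ifs <;> norm_num
  · rw [netflow_single, Pi.single_neg, Pi.single_neg]
    abel

open Classical in
/-- A flow `f` minimizes the amount sent to `t` from any set of the form
`residualReach f s ∩ [n]`. -/
lemma sum_le_of_residualReach {f g : Fin n ⊕ ↥(EG0 n G) ⊕ ↥(EG0 n G) → ℝ}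
    (hf : f ∈ capK n G k) (hg : g ∈ capK n G k) (s : Fin (n + 2)) :
    ∑ i with some i.succ.castSucc ∈ residualReach f (some s), f (Sum.inl i) ≤
      ∑ i with some i.succ.castSucc ∈ residualReach f (some s), g (Sum.inl i) := by
  set R := residualReach f (some s)
  set p : Option (Fin (n + 2)) → ℝ := fun v => if v ∈ R then 1 else 0 with hp
  obtain ⟨⟨hf0, hfn⟩, hf1⟩ := (mem_capK_iff f).1 hf
  obtain ⟨⟨hg0, hgn⟩, hg1⟩ := (mem_capK_iff g).1 hg
  have hpt : p none = 0 := if_neg (none_notMem_residualReach f s)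
  have hinl : ∀ h : Fin n ⊕ ↥(EG0 n G) ⊕ ↥(EG0 n G) → ℝ,
      ∑ v, p v * netflow (srcK n G) (tgtK n G) h v =
        ∑ i with some i.succ.castSucc ∈ R, h (Sum.inl i) +
          ∑ e, (p (srcK n G (Sum.inr e)) - p (tgtK n G (Sum.inr e))) * h (Sum.inr e) := by
    intro h
    rw [sum_mul_netflow, Fintype.sum_sum_type]
    congr 1
    rw [Finset.sum_filter]
    refine Finset.sum_congr rfl fun i _ => ?_
    simp only [srcK, tgtK, hpt, sub_zero]
    simp only [hp]
    split_ifs <;> simp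
  have hcut : ∑ e, (p (srcK n G (Sum.inr e)) - p (tgtK n G (Sum.inr e))) * g (Sum.inr e) ≤
      ∑ e, (p (srcK n G (Sum.inr e)) - p (tgtK n G (Sum.inr e))) * f (Sum.inr e) := by
    refine Finset.sum_le_sum fun e _ => ?_
    by_cases hs : srcK n G (Sum.inr e) ∈ R <;> by_cases ht : tgtK n G (Sum.inr e) ∈ R
    · simp [hp, hs, ht]
    · have : ∃ y, e = Sum.inr y ∧ f (Sum.inr e) = 1 := by
        by_contra! hc
        exact ht (tgt_mem_residualReach hs hc)
      obtain ⟨y, rfl, hy⟩ := this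
      simpa [hp, hs, ht, hy] using hg1 y
    · have : f (Sum.inr e) = 0 := by
        by_contra hc
        exact hs (src_mem_residualReach ht hc)
      simpa [hp, hs, ht, this] using hg0 (Sum.inr e)
    · simp [hp, hs, ht]
  have h1 := hinl f
  have h2 := hinl g
  rw [hfn] at h1
  rw [hgn] at h2
  linarith

/-- Rerouting a small amount of flow from the edge at `i` to the edge at `j`. -/
lemma exists_reroute {f : Fin n ⊕ ↥(EG0 n G) ⊕ ↥(EG0 n G) → ℝ} (hf : f ∈ capK n G k)
    {i j : Fin n} (hij : i ≠ j) (hi : 0 < f (Sum.inl i))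
    (hj : some j.succ.castSucc ∈ residualReach f (some i.succ.castSucc)) {δ : ℝ} (hδ : 0 < δ) :
    ∃ g ∈ capK n G k, ∃ ε, 0 < ε ∧ ε < δ ∧ g (Sum.inl i) = f (Sum.inl i) - ε ∧
      g (Sum.inl j) = f (Sum.inl j) + ε ∧
      ∀ l, l ≠ i → l ≠ j → g (Sum.inl l) = f (Sum.inl l) := by
  obtain ⟨⟨hf0, hfn⟩, hf1⟩ := (mem_capK_iff f).1 hf
  obtain ⟨D, hD, hDn⟩ := hj
  set E := D - Pi.single (Sum.inl i) 1 + Pi.single (Sum.inl j) 1 with hE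
  have hEn : netflow (srcK n G) (tgtK n G) E = 0 := by
    rw [hE, map_add, map_sub, netflow_single, netflow_single, hDn]
    simp only [srcK, tgtK]
    abel
  have hEr : ∀ e, E (Sum.inr e) = D (Sum.inr e) := fun e => by simp [hE]
  have hEi : E (Sum.inl i) = -1 := by simp [hE, hD.1, hij]
  have hEj : E (Sum.inl j) = 1 := by simp [hE, hD.1, hij.symm]
  have hEl : ∀ l, l ≠ i → l ≠ j → E (Sum.inl l) = 0 := fun l h1 h2 => by
    simp [hE, hD.1, h1, h2]
  have ht : ∀ e, Filter.Tendsto (fun ε : ℝ => f e + ε * E e)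
      (nhdsWithin 0 (Set.Ioi 0)) (nhds (f e)) := by
    intro e
    have : Continuous fun ε : ℝ => f e + ε * E e := by fun_prop
    have h := this.tendsto 0
    simp only [zero_mul, add_zero] at h
    exact h.mono_left nhdsWithin_le_nhds
  have hlow : ∀ e, ∀ᶠ ε in nhdsWithin (0 : ℝ) (Set.Ioi 0), 0 ≤ f e + ε * E e := by
    intro e
    rcases (hf0 e).lt_or_eq with h | h
    · exact (ht e).eventually_const_le h
    · have hEe : 0 ≤ E e := by
        rcases e with l | e
        · by_cases hl : l = i
          · subst hl
            exact absurd h hi.ne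
          · by_cases hl' : l = j
            · rw [hl', hEj]
              exact zero_le_one
            · exact (hEl l hl hl').ge
        · rw [hEr]
          exact hD.2.1 e h.symm
      filter_upwards [self_mem_nhdsWithin] with ε hε
      exact add_nonneg (hf0 e) (mul_nonneg (le_of_lt hε) hEe)
  have hup : ∀ e : ↥(EG0 n G), ∀ᶠ ε in nhdsWithin (0 : ℝ) (Set.Ioi 0),
      f (Sum.inr (Sum.inr e)) + ε * E (Sum.inr (Sum.inr e)) ≤ 1 := by
    intro e
    rcases (hf1 e).lt_or_eq with h | h
    · exact (ht _).eventually_le_const h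
    · filter_upwards [self_mem_nhdsWithin] with ε hε
      have := mul_nonpos_of_nonneg_of_nonpos (le_of_lt hε) (hD.2.2 e h)
      rw [hEr]
      linarith
  have hsmall : ∀ᶠ ε in nhdsWithin (0 : ℝ) (Set.Ioi 0), ε < δ :=
    nhdsWithin_le_nhds (eventually_lt_nhds hδ)
  obtain ⟨ε, ⟨⟨h1, h2⟩, h3⟩, hε⟩ := (((Filter.eventually_all.2 hlow).and
    (Filter.eventually_all.2 hup)).and hsmall).and
      (self_mem_nhdsWithin (a := (0 : ℝ)) (s := Set.Ioi 0)) |>.exists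
  refine ⟨f + ε • E, (mem_capK_iff _).2 ⟨⟨h1, ?_⟩, h2⟩, ε, hε, h3, ?_, ?_, ?_⟩
  · rw [map_add, map_smul, hEn, smul_zero, add_zero, hfn]
  · simp [hEi, sub_eq_add_neg]
  · simp [hEj]
  · intro l h1 h2
    simp [hEl l h1 h2]

/-- Every point of the generalized permutahedron lifts to a capacitated flow. -/
lemma exists_flow_of_zK_le (hG : ∀ e ∈ G, e.1 < e.2) (hne : (capK n G k).Nonempty)
    {x : Fin n → ℝ} (hx : ∀ I : Finset (Fin n), zK n G k I ≤ ∑ i ∈ I, x i)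
    (hsum : ∑ i, x i = zK n G k Finset.univ) :
    ∃ f ∈ capK n G k, ∀ i, f (Sum.inl i) = x i := by
  classical
  obtain ⟨f, hf, hmax⟩ := (isCompact_capK hG).exists_isMaxOn hne
    (f := fun f => ∑ i, min (f (Sum.inl i)) (x i)) (by fun_prop)
  refine ⟨f, hf, ?_⟩
  by_contra! hneq
  have hexcess : ∃ i, x i < f (Sum.inl i) := by
    by_contra! hle
    obtain ⟨i, hi⟩ := hneq
    have := Finset.sum_lt_sum (fun i _ => hle i) ⟨i, Finset.mem_univ i, lt_of_le_of_ne (hle i) hi⟩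
    rw [sum_inl_of_mem_capK hf, hsum, zK_univ hne] at this
    exact lt_irrefl _ this
  obtain ⟨i, hi⟩ := hexcess
  have hxi : 0 ≤ x i := by
    have := (zK_nonneg _).trans (hx {i})
    simpa using this
  have hreach : ∀ j, some j.succ.castSucc ∈ residualReach f (some i.succ.castSucc) →
      x j ≤ f (Sum.inl j) := by
    intro j hj
    by_contra! hjx
    have hij : i ≠ j := by
      rintro rfl
      exact lt_asymm hi hjx
    obtain ⟨g, hg, ε, hε0, hεδ, hgi, hgj, hgl⟩ := exists_reroute hf hij (hxi.trans_lt hi) hj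
      (sub_pos.2 hi)
    have hle : ∑ l, min (g (Sum.inl l)) (x l) ≤ ∑ l, min (f (Sum.inl l)) (x l) := hmax hg
    refine not_lt_of_ge hle (Finset.sum_lt_sum (fun l _ => ?_) ⟨j, Finset.mem_univ j, ?_⟩)
    · by_cases hli : l = i
      · subst hli
        rw [hgi]
        refine le_min ?_ (min_le_right _ _)
        exact (min_le_right _ _).trans (by linarith)
      · by_cases hlj : l = j
        · subst hlj
          rw [hgj]
          exact min_le_min_right _ (by linarith)
        · rw [hgl l hli hlj]
    · rw [hgj, min_eq_left hjx.le]
      exact lt_min (by linarith) hjx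
  set I : Finset (Fin n) := Finset.univ.filter fun j =>
    some j.succ.castSucc ∈ residualReach f (some i.succ.castSucc) with hI
  have hlt : ∑ j ∈ I, x j < ∑ j ∈ I, f (Sum.inl j) := by
    refine Finset.sum_lt_sum (fun j hj => hreach j (Finset.mem_filter.1 hj).2) ⟨i, ?_, hi⟩
    exact Finset.mem_filter.2 ⟨Finset.mem_univ i, self_mem_residualReach f _⟩
  have hmin : ∑ j ∈ I, f (Sum.inl j) ≤ zK n G k I := by
    refine le_csInf (hne.image _) ?_
    rintro _ ⟨g, hg, rfl⟩
    exact sum_le_of_residualReach hf hg _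
  exact absurd (hx I) (not_le_of_gt (hlt.trans_le hmin))

/-- A capacitated flow is a convex combination of integral capacitated flows, which agree with it
on the edges to `t` wherever it takes integral values there. -/
lemma mem_convexHull_integral_capK {f : Fin n ⊕ ↥(EG0 n G) ⊕ ↥(EG0 n G) → ℝ}
    (hf : f ∈ capK n G k) :
    f ∈ convexHull ℝ {g | g ∈ capK n G k ∧ (∀ e, ∃ z : ℤ, g e = z) ∧
      ∀ e, (∃ z : ℤ, f e = z) → g e = f e} := by
  obtain ⟨⟨hf0, hfn⟩, hf1⟩ := (mem_capK_iff f).1 hf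
  refine convexHull_mono ?_ (mem_convexHull_integral (src := srcK n G) (tgt := tgtK n G) f
    fun v => by rw [hfn]; exact exists_int_bK v)
  rintro g ⟨hgn, hgb, hgz⟩
  refine ⟨(mem_capK_iff g).2 ⟨⟨fun e => ?_, hgn.trans hfn⟩, fun e => ?_⟩, hgz, ?_⟩
  · refine le_trans ?_ (hgb e).1
    exact_mod_cast Int.floor_nonneg.2 (hf0 e)
  · refine (hgb _).2.trans ?_
    have : ⌈f (Sum.inr (Sum.inr e))⌉ ≤ 1 := Int.ceil_le.2 (by simpa using hf1 e)
    exact_mod_cast this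
  · rintro e ⟨z, hz⟩
    have := hgb e
    rw [hz, Int.floor_intCast, Int.ceil_intCast] at this
    rw [hz]
    exact le_antisymm this.2 this.1

end CapacitatedFlows

/-- Theorem: the Newton polytope of `L_G^k` is a generalized
permutahedron with polytopal support.  For a simple graph `G` on `[0,n]` and `k ≥ 0`
with `P^c_k` nonempty, the convex hull of the projections `φ(f)` of the integral flows
`f ∈ P^c_k` equals the generalized permutahedron
`P = { x : ∑_{i∈I} x_i ≥ z_I^(k) for proper I ⊆ [n], ∑ x_i = z_{[n]}^(k) }`, and every
integer point of `P` is `φ(f)` for some integral flow `f ∈ P^c_k`. -/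
theorem newton_component_genPerm (n : ℕ) (G : Finset (Fin (n + 1) × Fin (n + 1)))
    (hG : ∀ e ∈ G, e.1 < e.2) (k : ℕ) (hne : (capK n G k).Nonempty) :
    convexHull ℝ {x : Fin n → ℝ | ∃ f ∈ capK n G k,
        (∀ e, ∃ z : ℤ, f e = (z : ℝ)) ∧ x = fun i => f (Sum.inl i)} =
      {x : Fin n → ℝ |
        (∀ I : Finset (Fin n), I ≠ Finset.univ → zK n G k I ≤ ∑ i ∈ I, x i) ∧
        ∑ i, x i = zK n G k Finset.univ} ∧
    ∀ x : Fin n → ℝ,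
      ((∀ I : Finset (Fin n), I ≠ Finset.univ → zK n G k I ≤ ∑ i ∈ I, x i) ∧
        ∑ i, x i = zK n G k Finset.univ) →
      (∀ i, ∃ z : ℤ, x i = (z : ℝ)) →
      ∃ f ∈ capK n G k, (∀ e, ∃ z : ℤ, f e = (z : ℝ)) ∧ x = fun i => f (Sum.inl i) := by
  have hall : ∀ x : Fin n → ℝ,
      ((∀ I : Finset (Fin n), I ≠ Finset.univ → zK n G k I ≤ ∑ i ∈ I, x i) ∧
        ∑ i, x i = zK n G k Finset.univ) → ∃ f ∈ capK n G k, ∀ i, f (Sum.inl i) = x i := by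
    rintro x ⟨hx, hsum⟩
    refine exists_flow_of_zK_le hG hne (fun I => ?_) hsum
    by_cases hI : I = Finset.univ
    · exact hI ▸ hsum.ge
    · exact hx I hI
  refine ⟨Set.Subset.antisymm (convexHull_min ?_ ?_) ?_, ?_⟩
  · rintro _ ⟨f, hf, -, rfl⟩
    exact ⟨fun I _ => zK_le_of_mem_capK hf I, by rw [zK_univ hne, sum_inl_of_mem_capK hf]⟩
  · rintro x ⟨hx, hxs⟩ y ⟨hy, hys⟩ a b ha hb hab
    have hsum : ∀ I : Finset (Fin n), ∑ i ∈ I, (a • x + b • y) i =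
        a * ∑ i ∈ I, x i + b * ∑ i ∈ I, y i := fun I => by
      simp [Finset.sum_add_distrib, Finset.mul_sum]
    refine ⟨fun I hI => ?_, ?_⟩
    · rw [hsum, ← one_mul (zK n G k I), ← hab, add_mul]
      exact add_le_add (mul_le_mul_of_nonneg_left (hx I hI) ha)
        (mul_le_mul_of_nonneg_left (hy I hI) hb)
    · rw [hsum, hxs, hys, ← add_mul, hab, one_mul]
  · intro x hx
    obtain ⟨f, hf, hfx⟩ := hall x hx
    have hmem := Set.mem_image_of_mem (LinearMap.funLeft ℝ ℝ Sum.inl)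
      (mem_convexHull_integral_capK hf)
    rw [LinearMap.image_convexHull] at hmem
    have hxf : LinearMap.funLeft ℝ ℝ Sum.inl f = x := funext hfx
    rw [hxf] at hmem
    refine convexHull_mono ?_ hmem
    rintro _ ⟨g, ⟨hg, hgz, -⟩, rfl⟩
    exact ⟨g, hg, hgz, rfl⟩
  · intro x hx hxz
    obtain ⟨f, hf, hfx⟩ := hall x hx
    obtain ⟨g, hg, hgz, hgf⟩ := convexHull_nonempty_iff.1 ⟨f, mem_convexHull_integral_capK hf⟩
    refine ⟨g, hg, hgz, funext fun i => ?_⟩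
    rw [hgf (Sum.inl i) (hfx i ▸ hxz i), hfx]
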